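/- Fix integers n ≥ 1 and 0 ≤ q ≤ n and a real number α ≠ 0 with α > 0 or α < 0. Let g be the diagonal n×n matrix diag(−1,…,−1,1,…,1) with q entries −1, and let E be the space of symmetric n×n real matrices. Consider on E the symmetric bilinear form γ^α_g(h,k) = tr((g⁻¹h)₀(g⁻¹k)₀) + α·tr(g⁻¹h)·tr(g⁻¹k), where A₀ = A − (tr(A)/n)·I. Then there exist subspaces P and N of E with E = P ⊕ N, γ^α_g(x,y) = 0 for all x ∈ P, y ∈ N, γ^α_g positive definite on P and negative definite on N, and dim N = q(n−q) if α > 0, while dim N = q(n−q) + 1 if α < 0. -/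

import Mathlib

open Matrix

/-- The subspace of symmetric `n×n` real matrices. -/
def symmSub (n : ℕ) : Submodule ℝ (Matrix (Fin n) (Fin n) ℝ) where
  carrier := {A | Aᵀ = A}
  add_mem' := by
    intro A B hA hB
    simp only [Set.mem_setOf_eq, Matrix.transpose_add] at *
    rw [hA, hB]
  zero_mem' := Matrix.transpose_zero
  smul_mem' := by
    intro c A hA
    simp only [Set.mem_setOf_eq, Matrix.transpose_smul] at *
    rw [hA]

/-- The bilinear form `γ^α_g(h,k) = tr((g⁻¹h)₀(g⁻¹k)₀) + α·tr(g⁻¹h)·tr(g⁻¹k)`,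
where `A₀ = A − (tr(A)/n)·I`. -/
noncomputable def gammaAlphaAt (n : ℕ) (α : ℝ) (g : Matrix (Fin n) (Fin n) ℝ)
    (h k : Matrix (Fin n) (Fin n) ℝ) : ℝ :=
  (((g⁻¹ * h) - ((g⁻¹ * h).trace / (n : ℝ)) • (1 : Matrix (Fin n) (Fin n) ℝ)) *
      ((g⁻¹ * k) - ((g⁻¹ * k).trace / (n : ℝ)) • (1 : Matrix (Fin n) (Fin n) ℝ))).trace +
    α * (g⁻¹ * h).trace * (g⁻¹ * k).trace


noncomputable def sgn12 (n q : ℕ) (i : Fin n) : ℝ := if (i : ℕ) < q then (-1 : ℝ) else 1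

lemma sgn12_sq (n q : ℕ) (i : Fin n) : sgn12 n q i * sgn12 n q i = 1 := by
  unfold sgn12; split_ifs <;> norm_num

/-- the twisted trace -/
noncomputable def tt12 (n q : ℕ) : Matrix (Fin n) (Fin n) ℝ →ₗ[ℝ] ℝ where
  toFun h := ∑ i, sgn12 n q i * h i i
  map_add' := by intro x y; simp [mul_add, Finset.sum_add_distrib]
  map_smul' := by
    intro c x
    simp only [Matrix.smul_apply, smul_eq_mul, RingHom.id_apply, Finset.mul_sum]
    exact Finset.sum_congr rfl fun i _ => by ring

lemma tt12_apply (n q : ℕ) (h : Matrix (Fin n) (Fin n) ℝ) :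
    tt12 n q h = ∑ i, sgn12 n q i * h i i := rfl

def Bsub12 (n q : ℕ) : Submodule ℝ (Matrix (Fin n) (Fin n) ℝ) where
  carrier := {A | (∀ i j, A j i = A i j) ∧ ∀ i j : Fin n, ((i : ℕ) < q ↔ (j : ℕ) < q) → A i j = 0}
  add_mem' := by
    rintro A B ⟨hA, hA'⟩ ⟨hB, hB'⟩
    refine ⟨fun i j => by simp [hA i j, hB i j], fun i j h => by simp [hA' i j h, hB' i j h]⟩
  zero_mem' := by simp
  smul_mem' := by
    rintro c A ⟨hA, hA'⟩
    refine ⟨fun i j => by simp [hA i j], fun i j h => by simp [hA' i j h]⟩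

def Asub12 (n q : ℕ) : Submodule ℝ (Matrix (Fin n) (Fin n) ℝ) where
  carrier := {A | (∀ i j, A j i = A i j) ∧
    ∀ i j : Fin n, ¬ ((i : ℕ) < q ↔ (j : ℕ) < q) → A i j = 0}
  add_mem' := by
    rintro A B ⟨hA, hA'⟩ ⟨hB, hB'⟩
    refine ⟨fun i j => by simp [hA i j, hB i j], fun i j h => by simp [hA' i j h, hB' i j h]⟩
  zero_mem' := by simp
  smul_mem' := by
    rintro c A ⟨hA, hA'⟩
    refine ⟨fun i j => by simp [hA i j], fun i j h => by simp [hA' i j h]⟩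

lemma gamma12 (n q : ℕ) (hn : 1 ≤ n) (α : ℝ) (h k : Matrix (Fin n) (Fin n) ℝ) :
    gammaAlphaAt n α (Matrix.diagonal (sgn12 n q)) h k =
      (∑ i, ∑ j, sgn12 n q i * sgn12 n q j * (h i j * k j i))
        + (α - 1 / n) * tt12 n q h * tt12 n q k := by
  have hinv : (Matrix.diagonal (sgn12 n q))⁻¹ = Matrix.diagonal (sgn12 n q) := by
    apply Matrix.inv_eq_right_inv
    rw [Matrix.diagonal_mul_diagonal]
    simp [sgn12_sq]
  have htr : ∀ h : Matrix (Fin n) (Fin n) ℝ,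
      (Matrix.diagonal (sgn12 n q) * h).trace = tt12 n q h := by
    intro h
    simp [Matrix.trace, tt12_apply, Matrix.diagonal_mul]
  have hn' : (n : ℝ) ≠ 0 := by positivity
  have hprod : (Matrix.diagonal (sgn12 n q) * h * (Matrix.diagonal (sgn12 n q) * k)).trace =
      ∑ i, ∑ j, sgn12 n q i * sgn12 n q j * (h i j * k j i) := by
    simp only [Matrix.trace, Matrix.diag_apply, Matrix.mul_apply (M := _ * h), Matrix.diagonal_mul]
    exact Finset.sum_congr rfl fun i _ => Finset.sum_congr rfl fun j _ => by ring
  unfold gammaAlphaAt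
  rw [hinv, htr, htr]
  simp only [sub_mul, mul_sub, Matrix.trace_sub, hprod, Matrix.smul_mul, Matrix.mul_smul,
    Matrix.one_mul, Matrix.mul_one, Matrix.trace_smul, htr, Matrix.trace_one, Fintype.card_fin,
    smul_eq_mul]
  field_simp
  ring

lemma tt12_B (n q : ℕ) {b : Matrix (Fin n) (Fin n) ℝ} (hb : b ∈ Bsub12 n q) : tt12 n q b = 0 := by
  rw [tt12_apply]
  exact Finset.sum_eq_zero fun i _ => by rw [hb.2 i i Iff.rfl, mul_zero]

lemma tt12_g (n q : ℕ) : tt12 n q (Matrix.diagonal (sgn12 n q)) = n := by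
  simp [tt12_apply, sgn12_sq]

lemma sgn12_same (n q : ℕ) {i j : Fin n} (h : (i : ℕ) < q ↔ (j : ℕ) < q) :
    sgn12 n q i * sgn12 n q j = 1 := by
  unfold sgn12; split_ifs <;> first | (exfalso; tauto) | norm_num

lemma sgn12_diff (n q : ℕ) {i j : Fin n} (h : ¬ ((i : ℕ) < q ↔ (j : ℕ) < q)) :
    sgn12 n q i * sgn12 n q j = -1 := by
  unfold sgn12; split_ifs <;> first | (exfalso; tauto) | norm_num

lemma g12_mem (n q : ℕ) : Matrix.diagonal (sgn12 n q) ∈ Asub12 n q := by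
  constructor
  · intro i j
    by_cases h : i = j
    · rw [h]
    · rw [Matrix.diagonal_apply_ne _ h, Matrix.diagonal_apply_ne _ (Ne.symm h)]
  · intro i j h
    apply Matrix.diagonal_apply_ne
    rintro rfl
    exact h Iff.rfl

lemma A12_le (n q : ℕ) : Asub12 n q ≤ symmSub n := fun x hx => by
  show xᵀ = x
  ext i j; exact hx.1 i j

lemma B12_le (n q : ℕ) : Bsub12 n q ≤ symmSub n := fun x hx => by
  show xᵀ = x
  ext i j; exact hx.1 i j

lemma AB12_inf (n q : ℕ) : Asub12 n q ⊓ Bsub12 n q = ⊥ := by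
  rw [eq_bot_iff]
  rintro x ⟨hA, hB⟩
  rw [Submodule.mem_bot]
  ext i j
  by_cases h : ((i : ℕ) < q ↔ (j : ℕ) < q)
  · exact hB.2 i j h
  · exact hA.2 i j h

lemma AB12_dec (n q : ℕ) {x : Matrix (Fin n) (Fin n) ℝ} (hx : x ∈ symmSub n) :
    ∃ a ∈ Asub12 n q, ∃ b ∈ Bsub12 n q, a + b = x := by
  have hx' : ∀ i j, x j i = x i j := fun i j => congrFun (congrFun (show xᵀ = x from hx) i) j
  refine ⟨Matrix.of fun i j => if ((i : ℕ) < q ↔ (j : ℕ) < q) then x i j else 0, ⟨?_, ?_⟩,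
    Matrix.of fun i j => if ((i : ℕ) < q ↔ (j : ℕ) < q) then 0 else x i j, ⟨?_, ?_⟩, ?_⟩
  · intro i j
    simp only [Matrix.of_apply, hx' i j]
    simp only [iff_comm]
  · intro i j h
    simp only [Matrix.of_apply, if_neg h]
  · intro i j
    simp only [Matrix.of_apply, hx' i j]
    simp only [iff_comm]
  · intro i j h
    simp only [Matrix.of_apply, if_pos h]
  · ext i j
    simp only [Matrix.add_apply, Matrix.of_apply]
    split_ifs <;> simp

lemma finrank_B12 (n q : ℕ) (hq : q ≤ n) : Module.finrank ℝ (Bsub12 n q) = q * (n - q) := by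
  let e : Bsub12 n q ≃ₗ[ℝ] ({i : Fin n // (i : ℕ) < q} × {i : Fin n // ¬ (i : ℕ) < q} → ℝ) :=
    { toFun := fun x p => x.1 p.1.1 p.2.1
      map_add' := fun x y => by ext p; simp
      map_smul' := fun c x => by ext p; simp
      invFun := fun f => ⟨Matrix.of fun i j =>
        if hi : (i : ℕ) < q then (if hj : (j : ℕ) < q then 0 else f (⟨i, hi⟩, ⟨j, hj⟩))
        else (if hj : (j : ℕ) < q then f (⟨j, hj⟩, ⟨i, hi⟩) else 0), by
          constructor
          · intro i j
            simp only [Matrix.of_apply]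
            split_ifs <;> rfl
          · intro i j h
            simp only [Matrix.of_apply]
            split_ifs <;> first | rfl | (exfalso; tauto)⟩
      left_inv := by
        rintro ⟨x, hx⟩
        ext i j
        simp only [Matrix.of_apply]
        split_ifs with h1 h2 h2
        · exact (hx.2 i j (by tauto)).symm
        · rfl
        · exact hx.1 i j
        · exact (hx.2 i j (by tauto)).symm
      right_inv := by
        intro f
        ext ⟨⟨i, hi⟩, ⟨j, hj⟩⟩
        simp only [Matrix.of_apply]
        rw [dif_pos hi, dif_neg hj] }
  have hc : Fintype.card {i : Fin n // (i : ℕ) < q} = q := by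
    rw [Fintype.card_subtype, Fin.card_filter_val_lt]
    omega
  rw [e.finrank_eq, Module.finrank_fintype_fun_eq_card, Fintype.card_prod,
    Fintype.card_subtype_compl, hc, Fintype.card_fin]

/-- form on A -/
lemma QA12 (n q : ℕ) {x : Matrix (Fin n) (Fin n) ℝ} (hx : x ∈ Asub12 n q) :
    (∑ i, ∑ j, sgn12 n q i * sgn12 n q j * (x i j * x j i)) = ∑ i, ∑ j, x i j ^ 2 := by
  refine Finset.sum_congr rfl fun i _ => Finset.sum_congr rfl fun j _ => ?_
  by_cases h : ((i : ℕ) < q ↔ (j : ℕ) < q)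
  · rw [sgn12_same n q h, hx.1 i j]; ring
  · rw [hx.2 i j h]; ring

lemma QB12 (n q : ℕ) {x : Matrix (Fin n) (Fin n) ℝ} (hx : x ∈ Bsub12 n q) (c : ℝ) :
    (∑ i, ∑ j, sgn12 n q i * sgn12 n q j * ((x + c • Matrix.diagonal (sgn12 n q)) i j *
      (x + c • Matrix.diagonal (sgn12 n q)) j i)) = - (∑ i, ∑ j, x i j ^ 2) + c ^ 2 * n := by
  have : c ^ 2 * (n : ℝ) = ∑ i : Fin n, ∑ j : Fin n, if i = j then c ^ 2 else 0 := by
    simp [mul_comm]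
  rw [this, ← Finset.sum_neg_distrib, ← Finset.sum_add_distrib]
  refine Finset.sum_congr rfl fun i _ => ?_
  rw [← Finset.sum_neg_distrib, ← Finset.sum_add_distrib]
  refine Finset.sum_congr rfl fun j _ => ?_
  by_cases hij : i = j
  · subst hij
    have := sgn12_sq n q i
    simp only [Matrix.add_apply, Matrix.smul_apply, Matrix.diagonal_apply_eq, smul_eq_mul,
      hx.2 i i Iff.rfl, if_true, this]
    linear_combination c ^ 2 * this
  · simp only [Matrix.add_apply, Matrix.smul_apply, Matrix.diagonal_apply_ne _ hij,
      Matrix.diagonal_apply_ne _ (Ne.symm hij), smul_eq_mul, if_neg hij, hx.1 i j]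
    by_cases h : ((i : ℕ) < q ↔ (j : ℕ) < q)
    · rw [hx.2 i j h]; ring
    · rw [sgn12_diff n q h]; ring

lemma QAB12 (n q : ℕ) {x y : Matrix (Fin n) (Fin n) ℝ} (hx : x ∈ Asub12 n q)
    (hy : y ∈ Bsub12 n q) (c : ℝ) :
    (∑ i, ∑ j, sgn12 n q i * sgn12 n q j * (x i j *
      (y + c • Matrix.diagonal (sgn12 n q)) j i)) = c * tt12 n q x := by
  rw [tt12_apply, Finset.mul_sum]
  refine Finset.sum_congr rfl fun i _ => ?_
  rw [Finset.sum_eq_single i]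
  · simp only [Matrix.add_apply, Matrix.smul_apply, Matrix.diagonal_apply_eq, smul_eq_mul,
      hy.2 i i Iff.rfl, sgn12_sq]
    ring
  · intro j _ hij
    simp only [Matrix.add_apply, Matrix.smul_apply, Matrix.diagonal_apply_ne _ hij, smul_eq_mul]
    by_cases h : ((i : ℕ) < q ↔ (j : ℕ) < q)
    · rw [hy.2 j i h.symm]; ring
    · rw [hx.2 i j h]; ring
  · simp

lemma pos12 (n : ℕ) {x : Matrix (Fin n) (Fin n) ℝ} (hx : x ≠ 0) : 0 < ∑ i, ∑ j, x i j ^ 2 := by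
  have h0 : 0 ≤ ∑ i, ∑ j, x i j ^ 2 :=
    Finset.sum_nonneg fun i _ => Finset.sum_nonneg fun j _ => sq_nonneg _
  refine lt_of_le_of_ne h0 fun h => hx ?_
  ext i j
  have h1 := (Finset.sum_eq_zero_iff_of_nonneg
    (fun i _ => Finset.sum_nonneg fun j _ => sq_nonneg _)).1 h.symm i (Finset.mem_univ _)
  have h2 := (Finset.sum_eq_zero_iff_of_nonneg (fun j _ => sq_nonneg _)).1 h1 j (Finset.mem_univ _)
  simpa using h2

lemma cs12 (n q : ℕ) (x : Matrix (Fin n) (Fin n) ℝ) :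
    tt12 n q x ^ 2 ≤ n * ∑ i, ∑ j, x i j ^ 2 := by
  have h := sq_sum_le_card_mul_sum_sq (s := (Finset.univ : Finset (Fin n)))
    (f := fun i => sgn12 n q i * x i i)
  rw [← tt12_apply, Finset.card_univ, Fintype.card_fin] at h
  refine h.trans (mul_le_mul_of_nonneg_left ?_ (Nat.cast_nonneg n))
  refine Finset.sum_le_sum fun i _ => ?_
  have : (sgn12 n q i * x i i) ^ 2 = x i i ^ 2 := by
    linear_combination x i i ^ 2 * sgn12_sq n q i
  rw [this]
  exact Finset.single_le_sum (f := fun j => x i j ^ 2) (fun j _ => sq_nonneg _) (Finset.mem_univ i)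

theorem stmt12 (n q : ℕ) (hn : 1 ≤ n) (hq : q ≤ n) (α : ℝ) (hα : α ≠ 0)
    (g : Matrix (Fin n) (Fin n) ℝ)
    (hg : g = Matrix.diagonal (fun i : Fin n => if (i : ℕ) < q then (-1 : ℝ) else 1)) :
    ∃ P N : Submodule ℝ (Matrix (Fin n) (Fin n) ℝ),
      P ≤ symmSub n ∧ N ≤ symmSub n ∧
      P ⊓ N = ⊥ ∧ P ⊔ N = symmSub n ∧
      (∀ x ∈ P, ∀ y ∈ N, gammaAlphaAt n α g x y = 0) ∧
      (∀ x ∈ P, x ≠ 0 → 0 < gammaAlphaAt n α g x x) ∧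
      (∀ x ∈ N, x ≠ 0 → gammaAlphaAt n α g x x < 0) ∧
      (0 < α → Module.finrank ℝ N = q * (n - q)) ∧
      (α < 0 → Module.finrank ℝ N = q * (n - q) + 1) := by
  have hg' : g = Matrix.diagonal (sgn12 n q) := hg
  clear hg
  subst hg'
  have hn0 : (0 : ℝ) < n := by exact_mod_cast hn
  rcases lt_or_gt_of_ne hα with hneg | hpos
  · have hgne : Matrix.diagonal (sgn12 n q) ≠ 0 := fun h => by
      have := tt12_g n q
      rw [h, map_zero] at this
      exact hn0.ne this
    have hN : ∀ y ∈ Bsub12 n q ⊔ Submodule.span ℝ {Matrix.diagonal (sgn12 n q)},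
        ∃ b ∈ Bsub12 n q, ∃ c : ℝ, y = b + c • Matrix.diagonal (sgn12 n q) := by
      intro y hy
      obtain ⟨b, hb, z, hz, rfl⟩ := Submodule.mem_sup.1 hy
      obtain ⟨c, rfl⟩ := Submodule.mem_span_singleton.1 hz
      exact ⟨b, hb, c, rfl⟩
    have htN : ∀ b ∈ Bsub12 n q, ∀ c : ℝ,
        tt12 n q (b + c • Matrix.diagonal (sgn12 n q)) = c * n := by
      intro b hb c
      rw [map_add, map_smul, tt12_B n q hb, tt12_g, smul_eq_mul, zero_add]
    have hle : Bsub12 n q ⊔ Submodule.span ℝ {Matrix.diagonal (sgn12 n q)} ≤ symmSub n := by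
      refine sup_le (B12_le n q) ?_
      rw [Submodule.span_singleton_le_iff_mem]
      exact A12_le n q (g12_mem n q)
    refine ⟨Asub12 n q ⊓ LinearMap.ker (tt12 n q),
      Bsub12 n q ⊔ Submodule.span ℝ {Matrix.diagonal (sgn12 n q)},
      inf_le_left.trans (A12_le n q), hle, ?_, ?_, ?_, ?_, ?_, fun h => absurd h hneg.not_gt, ?_⟩
    · rw [eq_bot_iff]
      rintro x ⟨⟨hA, ht⟩, hx⟩
      obtain ⟨b, hb, c, rfl⟩ := hN x hx
      have ht' : tt12 n q (b + c • Matrix.diagonal (sgn12 n q)) = 0 := ht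
      rw [htN b hb] at ht'
      have hc : c = 0 := by
        rcases mul_eq_zero.1 ht' with h | h
        · exact h
        · exact absurd h hn0.ne'
      subst hc
      rw [zero_smul, add_zero] at hA ⊢
      rw [← AB12_inf n q]
      exact ⟨hA, hb⟩
    · refine le_antisymm (sup_le (inf_le_left.trans (A12_le n q)) hle) ?_
      intro x hx
      obtain ⟨a, ha, b, hb, rfl⟩ := AB12_dec n q hx
      refine Submodule.mem_sup.2
        ⟨a - (tt12 n q a / n) • Matrix.diagonal (sgn12 n q), ⟨?_, ?_⟩,
          b + (tt12 n q a / n) • Matrix.diagonal (sgn12 n q), ?_, by abel⟩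
      · exact Submodule.sub_mem _ ha (Submodule.smul_mem _ _ (g12_mem n q))
      · show tt12 n q _ = 0
        rw [map_sub, map_smul, tt12_g, smul_eq_mul]
        field_simp
        ring
      · exact Submodule.add_mem_sup hb (Submodule.smul_mem _ _ (Submodule.mem_span_singleton_self _))
    · rintro x ⟨hA, ht⟩ y hy
      have ht' : tt12 n q x = 0 := ht
      obtain ⟨b, hb, c, rfl⟩ := hN y hy
      rw [gamma12 n q hn, QAB12 n q hA hb, ht']
      ring
    · rintro x ⟨hA, ht⟩ hx
      have ht' : tt12 n q x = 0 := ht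
      rw [gamma12 n q hn, QA12 n q hA, ht']
      have := pos12 n hx
      linarith
    · intro x hx hx0
      obtain ⟨b, hb, c, rfl⟩ := hN x hx
      rw [gamma12 n q hn, QB12 n q hb, htN b hb]
      have e : -(∑ i, ∑ j, b i j ^ 2) + c ^ 2 * n + (α - 1 / n) * (c * n) * (c * n)
          = -(∑ i, ∑ j, b i j ^ 2) + α * (c * n) ^ 2 := by
        field_simp
        ring
      rw [e]
      have hb0 : 0 ≤ ∑ i, ∑ j, b i j ^ 2 :=
        Finset.sum_nonneg fun i _ => Finset.sum_nonneg fun j _ => sq_nonneg _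
      by_cases hc : c = 0
      · subst hc
        have hb1 : b ≠ 0 := fun h => hx0 (by rw [h]; simp)
        have := pos12 n hb1
        simp
        exact this
      · have : 0 < (c * n) ^ 2 := by positivity
        nlinarith [mul_neg_of_neg_of_pos hneg this]
    · intro _
      have h := Submodule.finrank_sup_add_finrank_inf_eq (Bsub12 n q)
        (Submodule.span ℝ {Matrix.diagonal (sgn12 n q)})
      have hinf : Bsub12 n q ⊓ Submodule.span ℝ {Matrix.diagonal (sgn12 n q)} = ⊥ := by
        rw [eq_bot_iff, ← AB12_inf n q]
        refine le_inf (inf_le_right.trans ?_) inf_le_left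
        rw [Submodule.span_singleton_le_iff_mem]
        exact g12_mem n q
      rw [hinf, finrank_bot, finrank_span_singleton hgne, finrank_B12 n q hq] at h
      simpa using h
  · refine ⟨Asub12 n q, Bsub12 n q, A12_le n q, B12_le n q, AB12_inf n q, ?_, ?_, ?_, ?_,
      fun _ => finrank_B12 n q hq, fun h => absurd h hpos.not_gt⟩
    · refine le_antisymm (sup_le (A12_le n q) (B12_le n q)) ?_
      intro x hx
      obtain ⟨a, ha, b, hb, rfl⟩ := AB12_dec n q hx
      exact Submodule.add_mem_sup ha hb
    · intro x hx y hy
      have := QAB12 n q hx hy 0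
      rw [zero_smul, add_zero] at this
      rw [gamma12 n q hn, this, tt12_B n q hy]
      ring
    · intro x hx hx0
      rw [gamma12 n q hn, QA12 n q hx]
      have h1 := pos12 n hx0
      have h2 := cs12 n q x
      by_cases ht : tt12 n q x = 0
      · rw [ht]; linarith
      · have h3 : 0 < α * tt12 n q x ^ 2 := by positivity
        have h4 : tt12 n q x ^ 2 / n ≤ ∑ i, ∑ j, x i j ^ 2 := by
          rw [div_le_iff₀ hn0]; linarith
        have e : (α - 1 / n) * tt12 n q x * tt12 n q x
          = α * tt12 n q x ^ 2 - tt12 n q x ^ 2 / n := by ring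
        rw [e]; linarith
    · intro x hx hx0
      have := QB12 n q hx 0
      rw [zero_smul, add_zero] at this
      rw [gamma12 n q hn, this, tt12_B n q hx]
      have := pos12 n hx0
      linarith
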